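/- Let U be a finite set with |U| = n ≥ 1, let F be a finite family of subsets of U, let M and k be positive integers, and let ε > 0 be a real number with ε·M·n ≥ |F| + k. Let G be the graph whose vertex set is the disjoint union of F and U × {1,…,M}, whose edges are: all pairs of distinct members of F, together with the pair {F, (u,i)} for every F ∈ F, u ∈ U, and i ∈ {1,…,M} such that u ∈ F. If there exists a set S of at most k vertices of G such that the induced subgraph G[S] is connected and |N_G[S]| > (1 − 1/e + 2ε)·M·n, where e is Euler's number, then there exists a subfamily F'' ⊆ F with |F''| ≤ k whose union has size greater than (1 − 1/e + ε)·n. -/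

import Mathlib

/-- The gadget graph for the coverage reduction: a clique on the family `𝓕`, plus `M`
copies of each universe element, where the vertex of a set `A ∈ 𝓕` is adjacent to the
copies `(u, i)` of exactly the elements `u ∈ A`. -/
def coverGraph {U : Type*} (𝓕 : Finset (Finset U)) (M : ℕ) :
    SimpleGraph ({A // A ∈ 𝓕} ⊕ (U × Fin M)) :=
  SimpleGraph.fromRel (fun x y =>
    match x, y with
    | Sum.inl _, Sum.inl _ => True
    | Sum.inl A, Sum.inr p => p.1 ∈ A.1
    | _, _ => False)

/-- Soundness of the coverage reduction: a connected set of at most `k` vertices of the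
gadget graph dominating more than `(1 - 1/e + 2ε)·M·n` vertices yields a subfamily of at
most `k` sets covering more than `(1 - 1/e + ε)·n` elements. -/
theorem stmt_12 {U : Type*} [Fintype U] [DecidableEq U]
    (𝓕 : Finset (Finset U)) (M k : ℕ) (hM : 0 < M) (hk : 0 < k)
    (hU : 1 ≤ Fintype.card U)
    (ε : ℝ) (hε : 0 < ε)
    (hεM : (𝓕.card : ℝ) + k ≤ ε * M * Fintype.card U)
    (S : Finset ({A // A ∈ 𝓕} ⊕ (U × Fin M)))
    (hScard : S.card ≤ k)
    (hconn : ((coverGraph 𝓕 M).induce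
      (S : Set ({A // A ∈ 𝓕} ⊕ (U × Fin M)))).Connected)
    (hdom : (1 - 1 / Real.exp 1 + 2 * ε) * ((M : ℝ) * Fintype.card U) <
      ({w : {A // A ∈ 𝓕} ⊕ (U × Fin M) |
          w ∈ S ∨ ∃ v ∈ S, (coverGraph 𝓕 M).Adj v w}.ncard : ℝ)) :
    ∃ F'' ⊆ 𝓕, F''.card ≤ k ∧
      (1 - 1 / Real.exp 1 + ε) * (Fintype.card U : ℝ) <
        ((F''.biUnion id).card : ℝ) := by
  classical
  set F : Finset (Finset U) := S.toLeft.image Subtype.val with hF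
  refine ⟨F, ?_, ?_, ?_⟩
  · intro A hA
    obtain ⟨B, _, rfl⟩ := Finset.mem_image.1 hA
    exact B.2
  · exact (Finset.card_image_le.trans Finset.card_toLeft_le).trans hScard
  · -- every dominated vertex is a set vertex, a member of `S`, or a copy of a covered element
    have hsub : {w : {A // A ∈ 𝓕} ⊕ (U × Fin M) |
        w ∈ S ∨ ∃ v ∈ S, (coverGraph 𝓕 M).Adj v w} ⊆
        (((Finset.univ : Finset {A // A ∈ 𝓕}).image Sum.inl ∪ S ∪
          ((F.biUnion id) ×ˢ (Finset.univ : Finset (Fin M))).image Sum.inr :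
          Finset ({A // A ∈ 𝓕} ⊕ (U × Fin M))) : Set ({A // A ∈ 𝓕} ⊕ (U × Fin M))) := by
      intro w hw
      rw [Finset.mem_coe, Finset.mem_union, Finset.mem_union]
      rcases hw with hw | ⟨v, hv, hvw⟩
      · exact Or.inl (Or.inr hw)
      · rcases w with B | p
        · exact Or.inl (Or.inl (Finset.mem_image_of_mem _ (Finset.mem_univ _)))
        · right
          apply Finset.mem_image_of_mem
          rw [Finset.mem_product]
          refine ⟨?_, Finset.mem_univ _⟩
          rcases v with A | q
          · have hp : p.1 ∈ A.1 := by
              simpa [coverGraph, SimpleGraph.fromRel_adj] using hvw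
            exact Finset.mem_biUnion.2
              ⟨A.1, Finset.mem_image_of_mem _ (Finset.mem_toLeft.2 hv), hp⟩
          · simp [coverGraph, SimpleGraph.fromRel_adj] at hvw
    have h1 := Set.ncard_le_ncard hsub (Finset.finite_toSet _)
    rw [Set.ncard_coe_finset] at h1
    have h2 : ((Finset.univ : Finset {A // A ∈ 𝓕}).image
        (Sum.inl : _ → {A // A ∈ 𝓕} ⊕ (U × Fin M))).card ≤ 𝓕.card := by
      refine Finset.card_image_le.trans ?_
      simp
    have h3 : (((F.biUnion id) ×ˢ (Finset.univ : Finset (Fin M))).image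
        (Sum.inr : _ → {A // A ∈ 𝓕} ⊕ (U × Fin M))).card ≤ (F.biUnion id).card * M := by
      refine Finset.card_image_le.trans ?_
      simp [Finset.card_product]
    have h4 := h1.trans ((Finset.card_union_le _ _).trans
      (Nat.add_le_add ((Finset.card_union_le _ _).trans (Nat.add_le_add h2 hScard)) h3))
    have h5 := (Nat.cast_le (α := ℝ)).2 h4
    push_cast at h5
    have hM' : (0 : ℝ) < M := by exact_mod_cast hM
    refine lt_of_mul_lt_mul_right ?_ hM'.le
    linarith
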